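/- Let ℓ and k be real numbers with ℓ ≥ 2 and k > 0, and let q : ℕ → ℝ be a sequence with q(1) ≥ k and q(i+1) ≥ (q(i) − 1)/ℓ for every i ≥ 1. Then q(i) ≥ ℓ for every natural number i with 1 ≤ i ≤ (log k)/(log ℓ) − 1. -/

import Mathlib

/-- A sequence that decreases in each step by at most `x ↦ (x - 1) / ℓ` loses at most a factor
`ℓ` per step, up to an additive error of `1`. -/
lemma le_add_one_mul_pow_of_sub_one_div_le {ℓ k : ℝ} (hℓ : 2 ≤ ℓ) {q : ℕ → ℝ} (hq1 : k ≤ q 1)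
    (hstep : ∀ i : ℕ, 1 ≤ i → (q i - 1) / ℓ ≤ q (i + 1)) (n : ℕ) :
    k ≤ (q (n + 1) + 1) * ℓ ^ n := by
  have h0 : 0 < ℓ := by linarith
  induction n with
  | zero => simp; linarith
  | succ n ih =>
    have h := (div_le_iff₀ h0).mp (hstep (n + 1) (by omega))
    calc k ≤ (q (n + 1) + 1) * ℓ ^ n := ih
      _ ≤ ((q (n + 1 + 1) + 1) * ℓ) * ℓ ^ n := by gcongr; linarith
      _ = (q (n + 1 + 1) + 1) * ℓ ^ (n + 1) := by ring

/-- Let `ℓ ≥ 2` and `k > 0` be reals, and let `q : ℕ → ℝ` satisfy `q 1 ≥ k` and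
`q (i+1) ≥ (q i − 1)/ℓ` for all `i ≥ 1`. Then `q i ≥ ℓ` for every natural number `i`
with `1 ≤ i ≤ log k / log ℓ − 1` (logarithms to base `ℓ`). -/
theorem potential_stays_large (ℓ k : ℝ) (hℓ : 2 ≤ ℓ) (hk : 0 < k)
    (q : ℕ → ℝ) (hq1 : k ≤ q 1)
    (hstep : ∀ i : ℕ, 1 ≤ i → (q i - 1) / ℓ ≤ q (i + 1)) :
    ∀ i : ℕ, 1 ≤ i → (i : ℝ) ≤ Real.log k / Real.log ℓ - 1 → ℓ ≤ q i := by
  intro i hi hle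
  obtain ⟨n, rfl⟩ := Nat.exists_eq_add_of_le' hi
  have h0 : 0 < ℓ := by linarith
  have hpow : ℓ ^ (n + 2) ≤ k := by
    rw [← Real.log_le_log_iff (by positivity) hk, Real.log_pow,
      ← le_div_iff₀ (Real.log_pos (by linarith))]
    push_cast at hle ⊢
    linarith
  have hsq : ℓ ^ 2 ≤ q (n + 1) + 1 := by
    refine le_of_mul_le_mul_right ?_ (pow_pos h0 n)
    calc ℓ ^ 2 * ℓ ^ n = ℓ ^ (n + 2) := by ring
      _ ≤ k := hpow
      _ ≤ _ := le_add_one_mul_pow_of_sub_one_div_le hℓ hq1 hstep n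
  nlinarith
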